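/- The coefficient of the monomial λ₁λ₂⋯λₙ in the polynomial ∏_{j=1}^{n} (∑_{i≠j} λᵢ) equals the derangement number !n (the number of permutations of {1,…,n} with no fixed points). -/

import Mathlib

theorem Finsupp.sum_single_one_eq_one_iff_bijective {ι : Type*} [Fintype ι] (f : ι → ι) :
    ∑ j, Finsupp.single (f j) 1 = Finsupp.equivFunOnFinite.symm (fun _ : ι => (1 : ℕ)) ↔
      Function.Bijective f := by
  classical
  have apply_eq_card (i : ι) : (∑ j, Finsupp.single (f j) (1 : ℕ)) i =
      (Finset.univ.filter fun j => f j = i).card := by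
    simp [Finsupp.finsetSum_apply, Finsupp.single_apply]
  simp only [Finsupp.ext_iff, apply_eq_card, Finsupp.equivFunOnFinite_symm_apply_apply,
    Function.bijective_iff_existsUnique, Finset.card_eq_one, Finset.eq_singleton_iff_unique_mem,
    Finset.mem_filter_univ, ExistsUnique]

/-- The coefficient of the product of all variables in a product of sums of variables counts the
permutations compatible with the index sets of the sums. -/
theorem MvPolynomial.coeff_one_prod_sum_X {ι R : Type*} [Fintype ι]
    [CommSemiring R] (s : ι → Finset ι) :
    MvPolynomial.coeff (Finsupp.equivFunOnFinite.symm fun _ : ι => (1 : ℕ))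
      (∏ j, ∑ i ∈ s j, (MvPolynomial.X i : MvPolynomial ι R)) =
      (Nat.card {σ : Equiv.Perm ι // ∀ j, σ j ∈ s j} : R) := by
  classical
  have prod_X (f : ι → ι) : ∏ j, (MvPolynomial.X (f j) : MvPolynomial ι R) =
      MvPolynomial.monomial (∑ j, Finsupp.single (f j) 1) 1 := by
    simp [MvPolynomial.X, MvPolynomial.monomial_sum_one]
  simp only [Finset.prod_univ_sum, MvPolynomial.coeff_sum, prod_X, MvPolynomial.coeff_monomial,
    Finsupp.sum_single_one_eq_one_iff_bijective, Finset.sum_boole,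
    Nat.card_eq_fintype_card, Fintype.card_subtype]
  congr 1
  symm
  refine Finset.card_bij (fun σ _ => σ) (fun σ hσ => ?_) (fun σ _ τ _ h => DFunLike.coe_injective h)
    fun f hf => ?_
  · simpa [σ.bijective] using hσ
  · rw [Finset.mem_filter, Fintype.mem_piFinset] at hf
    exact ⟨Equiv.ofBijective f hf.2, by simpa using hf.1, rfl⟩

/-- The coefficient of the monomial λ₁λ₂⋯λₙ in ∏_{j=1}^n (∑_{i≠j} λᵢ)
equals the derangement number !n. -/
theorem stmt_0 (n : ℕ) (hn : 1 ≤ n) :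
    MvPolynomial.coeff (Finsupp.equivFunOnFinite.symm fun _ : Fin n => (1 : ℕ))
      (∏ j : Fin n, ∑ i ∈ Finset.univ.filter (fun i => i ≠ j),
        (MvPolynomial.X i : MvPolynomial (Fin n) ℚ))
      = (numDerangements n : ℚ) := by
  rw [MvPolynomial.coeff_one_prod_sum_X, ← card_derangements_fin_eq_numDerangements,
    ← Nat.card_eq_fintype_card]
  congr 1
  exact Nat.card_congr (Equiv.subtypeEquivRight fun σ => by simp [derangements])
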